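/- arXiv:1209.2038 — 3 statements merged into one kernel-verified Lean document; each statement's English description precedes it below -/
import Mathlib

section
/- The map f is a bijection from Sto(G) onto the disjoint union Sto(G∖e) ⊔ Sto(G.e); moreover ℓ(f(η)) = ℓ(η) − 1 for every η ∈ Sto_A(G) and ℓ(f(η)) = ℓ(η) for every η ∈ Sto_B(G). -/
open Finset Polynomial

open scoped Classical

namespace SSM

variable {V : Type*} [Fintype V] [DecidableEq V]

/-- The degree of a vertex: sum of edge multiplicities to all other vertices.
    Vertices are `Option V`, with `none` playing the role of the sink `s`. -/
def deg (m : Option V → Option V → ℕ) (u : Option V) : ℕ := ∑ w : Option V, m u w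

/-- `m` is a symmetric, loop-free edge-multiplicity function whose underlying
    graph is connected. -/
def IsGraph (m : Option V → Option V → ℕ) : Prop :=
  (∀ u w, m u w = m w u) ∧ (∀ u, m u u = 0) ∧
    (SimpleGraph.fromRel fun u w : Option V => m u w ≠ 0).Connected

/-- An orientation of the multigraph: `o u w` copies of the edge `{u,w}` are
    oriented from `u` to `w`, and `o u w + o w u = m u w`. -/
def IsOrientation (m o : Option V → Option V → ℕ) : Prop :=
  ∀ u w, o u w + o w u = m u w

/-- In-degree of a vertex in an orientation. -/
def inDeg (o : Option V → Option V → ℕ) (w : Option V) : ℕ := ∑ u : Option V, o u w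

/-- A configuration is stable if every non-sink vertex carries at most its degree. -/
def Stable (m : Option V → Option V → ℕ) (η : V → ℕ) : Prop :=
  ∀ v : V, η v ≤ deg m (some v)

/-- `η` is compatible with the orientation `o`: for each non-sink vertex `v`,
    `in_O(v) ≥ 1 + l_η(v)`, stated additively as `deg v + 1 ≤ in_O(v) + η v`. -/
def Compatible (m o : Option V → Option V → ℕ) (η : V → ℕ) : Prop :=
  ∀ v : V, deg m (some v) + 1 ≤ inDeg o (some v) + η v

/-- The set `Sto(G)`: stable configurations compatible with at least one orientation. -/
def Sto (m : Option V → Option V → ℕ) (η : V → ℕ) : Prop :=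
  Stable m η ∧ ∃ o, IsOrientation m o ∧ Compatible m o η

/-- Total lacking number `ℓ(η) = ∑_v (deg v − η v)`. -/
def totalLacking (m : Option V → Option V → ℕ) (η : V → ℕ) : ℕ :=
  ∑ v : V, (deg m (some v) - η v)

/-- The lacking polynomial `L_G(x) = ∑_{η ∈ Sto(G)} x^{ℓ(η)}`. -/
noncomputable def lackingPoly (m : Option V → Option V → ℕ) : Polynomial ℤ :=
  ∑ η ∈ (Fintype.piFinset fun v : V => Finset.range (deg m (some v) + 1)).filter
      (fun η => Sto m η),
    (X : Polynomial ℤ) ^ totalLacking m η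

/-- The maximal stable configuration `η^max`. -/
def etaMax (m : Option V → Option V → ℕ) : V → ℕ := fun v => deg m (some v)

/-- A grain addition at some non-sink vertex. -/
def AddGrain (η η' : V → ℕ) : Prop := ∃ v : V, η' = Function.update η v (η v + 1)

/-- A legal partial toppling: some vertex `x` with `η x > deg x` sends `α u ≤ m x u`
    grains to each vertex `u` (grains sent to the sink are lost). -/
def PartialTopple (m : Option V → Option V → ℕ) (η η' : V → ℕ) : Prop :=
  ∃ x : V, deg m (some x) < η x ∧ ∃ α : Option V → ℕ, (∀ u, α u ≤ m (some x) u) ∧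
    ∀ v : V, η' v = if v = x then η x - ∑ u : Option V, α u else η v + α (some v)

/-- Reachability by a finite sequence of grain additions and legal partial topplings. -/
def Reaches (m : Option V → Option V → ℕ) : (V → ℕ) → (V → ℕ) → Prop :=
  Relation.ReflTransGen fun η η' => AddGrain η η' ∨ PartialTopple m η η'

/-- A legal full toppling (Abelian sandpile model): an unstable vertex `x` sends
    `m x u` grains to each vertex `u`. -/
def FullTopple (m : Option V → Option V → ℕ) (η η' : V → ℕ) : Prop :=
  ∃ x : V, deg m (some x) < η x ∧
    ∀ v : V, η' v = if v = x then η x - deg m (some x) else η v + m (some x) (some v)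

/-- `η` passes the burning algorithm: the non-sink vertices can be enumerated
    `v_1, …, v_n` with `η(v_i) > ∑_{j > i} m(v_i, v_j)`. -/
def Burns (m : Option V → Option V → ℕ) (η : V → ℕ) : Prop :=
  ∃ e : Fin (Fintype.card V) ≃ V, ∀ i : Fin (Fintype.card V),
    ∑ j ∈ Finset.univ.filter (fun j : Fin (Fintype.card V) => i < j),
      m (some (e i)) (some (e j)) < η (e i)

/-- An orientation is acyclic if the digraph with an arc `u → w` whenever
    `o u w ≥ 1` has no directed cycle. -/
def IsAcyclic (o : Option V → Option V → ℕ) : Prop :=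
  ∀ u : Option V, ¬ Relation.TransGen (fun x y : Option V => 1 ≤ o x y) u u

/-- Deletion of one copy of the edge `{a,b}`. -/
def deleteM (m : Option V → Option V → ℕ) (a b : V) (u w : Option V) : ℕ :=
  if (u = some a ∧ w = some b) ∨ (u = some b ∧ w = some a) then m u w - 1 else m u w

/-- Contraction of the edge `{a,b}`: merge `b` into `a` (the merged vertex `a.b` is
    represented by `a` in the subtype `{v // v ≠ b}`), delete all `k = m a b` edges
    between `a` and `b`, and add `k − 1` new edges between `a.b` and the sink. -/
def contractM (m : Option V → Option V → ℕ) (a b : V) :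
    Option {v : V // v ≠ b} → Option {v : V // v ≠ b} → ℕ
  | none, none => 0
  | none, some w =>
      if w.1 = a then m none (some a) + m none (some b) + (m (some a) (some b) - 1)
      else m none (some w.1)
  | some u, none =>
      if u.1 = a then m none (some a) + m none (some b) + (m (some a) (some b) - 1)
      else m (some u.1) none
  | some u, some w =>
      if u.1 = a then
        (if w.1 = a then 0 else m (some a) (some w.1) + m (some b) (some w.1))
      else if w.1 = a then m (some u.1) (some a) + m (some u.1) (some b)
      else m (some u.1) (some w.1)

/-- `Sto_A(G)`: configurations in `Sto(G)` having a compatible orientation with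
    `o(a,b) ≥ 1` and `l_η(b) > 0`. -/
def StoA (m : Option V → Option V → ℕ) (a b : V) (η : V → ℕ) : Prop :=
  Stable m η ∧ ∃ o, IsOrientation m o ∧ Compatible m o η ∧
    1 ≤ o (some a) (some b) ∧ η b < deg m (some b)

/-- `Sto_B(G) = Sto(G) ∖ Sto_A(G)`. -/
def StoB (m : Option V → Option V → ℕ) (a b : V) (η : V → ℕ) : Prop :=
  Sto m η ∧ ¬ StoA m a b η

/-- On `Sto_A(G)`, `f(η) = η − 1_a`, a configuration on `G∖e`. -/
def fA (a : V) (η : V → ℕ) : V → ℕ := Function.update η a (η a - 1)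

/-- On `Sto_B(G)`, `f(η)` is the configuration on `G.e` agreeing with `η` away from
    `a, b` and with `f(η)(a.b) = deg_{G.e}(a.b) − l_η(a) − l_η(b)`. -/
def fB (m : Option V → Option V → ℕ) (a b : V) (hab : a ≠ b) (η : V → ℕ)
    (v : {v : V // v ≠ b}) : ℕ :=
  if v.1 = a then
    deg (contractM m a b) (some ⟨a, hab⟩) -
      ((deg m (some a) - η a) + (deg m (some b) - η b))
  else η v.1

/-- `T = (V' ∪ {r}, E')` is a tree branch of `G`: a sub-multigraph (with edge
    multiplicities `mT` on non-sink vertices) which is a tree on `V' ∪ {r}`,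
    such that every `v ∈ V'` has all of its `G`-edges inside `T`, and which is
    attached to the rest of `G` only at `r ∈ V ∖ V'`. -/
structure IsTreeBranch (m : Option V → Option V → ℕ) (V' : Finset V) (r : V)
    (mT : V → V → ℕ) : Prop where
  not_mem : r ∉ V'
  symm : ∀ u v, mT u v = mT v u
  loopless : ∀ v, mT v v = 0
  le : ∀ u v, mT u v ≤ m (some u) (some v)
  support : ∀ u v, mT u v ≠ 0 → (u ∈ V' ∨ u = r) ∧ (v ∈ V' ∨ v = r)
  deg_eq : ∀ v ∈ V', ∑ u : V, mT v u = deg m (some v)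
  conn : ∀ v ∈ V', (SimpleGraph.fromRel fun x y : V => mT x y ≠ 0).Reachable r v
  card_edges : ∑ u : V, ∑ v : V, mT u v = 2 * V'.card

/-- The combined map `f` on `Sto(G)`, landing in the disjoint union
`Conf(G∖e) ⊕ Conf(G.e)`. -/
noncomputable def fMap (m : Option V → Option V → ℕ) (a b : V) (hab : a ≠ b)
    (η : V → ℕ) : (V → ℕ) ⊕ ({v : V // v ≠ b} → ℕ) :=
  if StoA m a b η then Sum.inl (fA a η) else Sum.inr (fB m a b hab η)

/-- Reverse one copy of the edge from `u` to `w`. -/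
def flipO (o : Option V → Option V → ℕ) (u w : Option V) (x y : Option V) : ℕ :=
  if x = u ∧ y = w then o x y - 1 else if x = w ∧ y = u then o x y + 1 else o x y

lemma flipO_orient {m o : Option V → Option V → ℕ} (ho : IsOrientation m o)
    {u w : Option V} (huw : u ≠ w) (h : 1 ≤ o u w) : IsOrientation m (flipO o u w) := by
  intro x y
  have h1 := ho x y
  unfold flipO
  by_cases hx : x = u ∧ y = w
  · obtain ⟨rfl, rfl⟩ := hx
    simp [huw, huw.symm]
    omega
  · by_cases hy : x = w ∧ y = u
    · obtain ⟨rfl, rfl⟩ := hy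
      simp [huw, huw.symm]
      omega
    · have hx' : ¬ (y = w ∧ x = u) := fun h => hx ⟨h.2, h.1⟩
      have hy' : ¬ (y = u ∧ x = w) := fun h => hy ⟨h.2, h.1⟩
      simp only [hx, hy, hx', hy', if_false]
      exact h1

lemma sum_ite_and (z u w : Option V) :
    ∑ x : Option V, (if x = u ∧ z = w then 1 else 0) = if z = w then 1 else 0 := by
  by_cases h : z = w <;> simp [h]

lemma flipO_inDeg (o : Option V → Option V → ℕ)
    {u w : Option V} (huw : u ≠ w) (h : 1 ≤ o u w) (z : Option V) :
    inDeg (flipO o u w) z + (if z = w then 1 else 0) = inDeg o z + (if z = u then 1 else 0) := by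
  rw [← sum_ite_and z u w, ← sum_ite_and z w u]
  unfold inDeg
  rw [← Finset.sum_add_distrib, ← Finset.sum_add_distrib]
  refine Finset.sum_congr rfl fun x _ => ?_
  unfold flipO
  by_cases hx : x = u ∧ z = w
  · obtain ⟨rfl, rfl⟩ := hx
    simp [huw]
    omega
  · by_cases hy : x = w ∧ z = u
    · obtain ⟨rfl, rfl⟩ := hy
      simp [huw]
    · simp only [hx, hy, if_false]

lemma aug {m : Option V → Option V → ℕ} (a b : V) (O : Option V → Option V → ℕ)
    (hO : IsOrientation m O) (R : V → ℕ) (hR : ∀ v, v ≠ b → R v ≤ inDeg O (some v)) :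
    ∀ (n : ℕ) (P : Option V → Option V → ℕ) (x : Option V), x ≠ some b →
      (∑ u, ∑ w, (P u w - O u w)) = n → IsOrientation m P →
      (∀ v, R v ≤ inDeg P (some v) + (if some v = x then 1 else 0)) →
      1 ≤ P (some b) (some a) →
      ∃ P', IsOrientation m P' ∧
        (∀ v, R v ≤ inDeg P' (some v) + (if v = b then 1 else 0)) ∧
        1 ≤ P' (some b) (some a) := by
  intro n
  induction n using Nat.strong_induction_on with
  | _ n ih =>
    intro P x hxb hn hP hRP hba
    cases x with
    | none =>
      exact ⟨P, hP, fun v => by have := hRP v; simp at this; omega, hba⟩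
    | some v =>
      by_cases hv : R v ≤ inDeg P (some v)
      · refine ⟨P, hP, fun z => ?_, hba⟩
        by_cases hz : z = v
        · subst hz; omega
        · have := hRP z; simp [hz] at this; omega
      · have hvb : v ≠ b := fun h => hxb (by rw [h])
        have hlt : inDeg P (some v) < inDeg O (some v) := lt_of_lt_of_le (not_le.mp hv) (hR v hvb)
        obtain ⟨y, -, hy⟩ := Finset.exists_lt_of_sum_lt hlt
        have e1 := hP y (some v)
        have e2 := hO y (some v)
        have hyv : some v ≠ y := by
          rintro rfl
          omega
        have hPv : O (some v) y < P (some v) y := by omega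
        have hP1 : 1 ≤ P (some v) y := by omega
        have hor := flipO_orient hP hyv hP1
        have hin := flipO_inDeg P hyv hP1
        have hba' : 1 ≤ flipO P (some v) y (some b) (some a) := by
          unfold flipO
          have : some b ≠ some v := by simpa using hvb.symm
          simp only [this, false_and, if_false]
          split_ifs <;> omega
        have hRP' : ∀ z, R z ≤ inDeg (flipO P (some v) y) (some z) +
            (if some z = y then 1 else 0) := by
          intro z
          rw [hin]
          exact hRP z
        by_cases hyb : y = some b
        · subst hyb
          refine ⟨_, hor, fun z => ?_, hba'⟩
          have := hRP' z
          simpa using this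
        · refine ih _ ?_ _ y hyb rfl hor hRP' hba'
          rw [← hn]
          have key : ∀ u w, flipO P (some v) y u w - O u w ≤ P u w - O u w := by
            intro u w
            unfold flipO
            split_ifs with h1 h2
            · omega
            · obtain ⟨rfl, rfl⟩ := h2
              omega
            · exact le_rfl
          refine Finset.sum_lt_sum (fun u _ => Finset.sum_le_sum fun w _ => key u w)
            ⟨some v, Finset.mem_univ _, Finset.sum_lt_sum (fun w _ => key _ w)
              ⟨y, Finset.mem_univ _, ?_⟩⟩
          simp [flipO]
          omega

lemma stoA_of_lt {m : Option V → Option V → ℕ} {a b : V} (hab : a ≠ b)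
    (hk : 1 ≤ m (some a) (some b)) {η η' : V → ℕ}
    (h : Sto m η) (h' : Sto m η') (hoff : ∀ v, v ≠ a → v ≠ b → η v = η' v)
    (hsum : η a + η b = η' a + η' b) (hlt : η' b < η b) : StoA m a b η' := by
  obtain ⟨hs, O, hO, hc⟩ := h
  obtain ⟨hs', O', hO', hc'⟩ := h'
  have hb' : η' b < deg m (some b) := lt_of_lt_of_le hlt (hs b)
  by_cases h1 : 1 ≤ O' (some a) (some b)
  · exact ⟨hs', O', hO', hc', h1, hb'⟩
  have hba : 1 ≤ O' (some b) (some a) := by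
    have := hO' (some a) (some b); omega
  obtain ⟨P, hP, hR, hPba⟩ := aug a b O hO
    (fun v => deg m (some v) + 1 - η' v + if v = a then 1 else 0) (by
      intro v hv
      have h2 := hc v
      have h3 := hs' v
      by_cases hva : v = a
      · subst hva; simp; omega
      · have := hoff v hva hv
        simp [hva]; omega) _ O' (some a) (by simpa using hab) rfl hO' (by
      intro v
      have h2 := hc' v
      by_cases hva : v = a
      · subst hva; simp; omega
      · simp [hva]; omega) hba
  have hne : some b ≠ some a := by simpa using hab.symm
  refine ⟨hs', flipO P (some b) (some a), flipO_orient hP hne hPba, ?_, ?_, hb'⟩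
  · intro v
    have h4 := flipO_inDeg P hne hPba (some v)
    have h5 := hR v
    have h6 := hs' v
    simp only [Option.some.injEq] at h4
    omega
  · simp [flipO, hab]

lemma self_zero {m o : Option V → Option V → ℕ} (hl : ∀ u, m u u = 0)
    (ho : IsOrientation m o) (u : Option V) : o u u = 0 := by
  have := ho u u; have := hl u; omega

lemma inDeg_le {m o : Option V → Option V → ℕ} (hs : ∀ u w, m u w = m w u)
    (ho : IsOrientation m o) (u : Option V) : inDeg o u ≤ deg m u := by
  refine Finset.sum_le_sum fun x _ => ?_
  have := ho x u; have := hs u x; omega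

lemma deg_delete {m : Option V → Option V → ℕ} (hs : ∀ u w, m u w = m w u)
    {a b : V} (hab : a ≠ b) (hk : 1 ≤ m (some a) (some b)) (v : V) :
    deg (deleteM m a b) (some v) + ((if v = a then 1 else 0) + (if v = b then 1 else 0))
      = deg m (some v) := by
  have h1 := sum_ite_and (some v) (some b) (some a)
  have h2 := sum_ite_and (some v) (some a) (some b)
  simp only [Option.some.injEq] at h1 h2
  rw [← h1, ← h2]
  unfold deg
  rw [← Finset.sum_add_distrib, ← Finset.sum_add_distrib]
  refine Finset.sum_congr rfl fun x _ => ?_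
  unfold deleteM
  have hk' := hs (some a) (some b)
  by_cases hx : x = some b ∧ v = a
  · obtain ⟨rfl, rfl⟩ := hx
    simp [hab]; omega
  · by_cases hy : x = some a ∧ v = b
    · obtain ⟨rfl, rfl⟩ := hy
      simp [hab.symm]; omega
    · have : ¬ ((some v = some a ∧ x = some b) ∨ (some v = some b ∧ x = some a)) := by
        simp only [Option.some.injEq]; tauto
      simp only [hx, hy, this, if_false]; omega

lemma fA_sto {m : Option V → Option V → ℕ} (hs : ∀ u w, m u w = m w u)
    {a b : V} (hab : a ≠ b) (hk : 1 ≤ m (some a) (some b)) {η : V → ℕ}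
    (h : StoA m a b η) : Sto (deleteM m a b) (fA a η) := by
  obtain ⟨hst, o, ho, hc, hoab, hlb⟩ := h
  have hd := deg_delete hs hab hk
  have hηa : 1 ≤ η a := by
    have := hc a; have := inDeg_le hs ho (some a); omega
  refine ⟨fun v => ?_, fun x y => if x = some a ∧ y = some b then o x y - 1 else o x y, ?_, ?_⟩
  · have h1 := hd v
    have h2 := hst v
    unfold fA
    by_cases hva : v = a
    · subst hva; simp [hab] at h1 ⊢; omega
    · by_cases hvb : v = b
      · subst hvb; simp [hva] at h1 ⊢; omega
      · simp [hva, hvb] at h1 ⊢; omega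
  · intro x y
    have h1 := ho x y
    unfold deleteM
    by_cases hx : x = some a ∧ y = some b
    · obtain ⟨rfl, rfl⟩ := hx
      simp [hab, hab.symm]; omega
    · by_cases hy : x = some b ∧ y = some a
      · obtain ⟨rfl, rfl⟩ := hy
        simp [hab, hab.symm]; omega
      · have h3 : ¬ (y = some a ∧ x = some b) := by tauto
        simp only [hx, hy, h3, if_false, or_false]; omega
  · intro v
    have h1 := hd v
    have h2 := hc v
    have h3 : inDeg (fun x y => if x = some a ∧ y = some b then o x y - 1 else o x y) (some v)
        + (if v = b then 1 else 0) = inDeg o (some v) := by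
      have h1 := sum_ite_and (some v) (some a) (some b)
      simp only [Option.some.injEq] at h1
      rw [← h1]
      unfold inDeg
      rw [← Finset.sum_add_distrib]
      refine Finset.sum_congr rfl fun x _ => ?_
      by_cases hx : x = some a ∧ v = b
      · obtain ⟨rfl, rfl⟩ := hx
        simp; omega
      · simp only [Option.some.injEq, hx, if_false]; rfl
    unfold fA
    by_cases hva : v = a
    · subst hva; simp [hab] at h1 h3 ⊢; omega
    · by_cases hvb : v = b
      · subst hvb; simp [hva] at h1 h3 ⊢; omega
      · simp [hva, hvb] at h1 h3 ⊢; omega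

lemma fA_surj {m : Option V → Option V → ℕ} (hs : ∀ u w, m u w = m w u)
    {a b : V} (hab : a ≠ b) (hk : 1 ≤ m (some a) (some b)) {ξ : V → ℕ}
    (h : Sto (deleteM m a b) ξ) : ∃ η, StoA m a b η ∧ fA a η = ξ := by
  obtain ⟨hst, o, ho, hc⟩ := h
  have hd := deg_delete hs hab hk
  refine ⟨Function.update ξ a (ξ a + 1), ⟨fun v => ?_,
    fun x y => if x = some a ∧ y = some b then o x y + 1 else o x y, ?_, ?_, ?_, ?_⟩, ?_⟩
  · have h1 := hd v
    have h2 := hst v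
    by_cases hva : v = a
    · subst hva; simp [hab] at h1 ⊢; omega
    · simp [hva] at h1 ⊢; omega
  · intro x y
    have h1 := ho x y
    unfold deleteM at h1
    have hk' := hs (some a) (some b)
    by_cases hx : x = some a ∧ y = some b
    · obtain ⟨rfl, rfl⟩ := hx
      simp [hab, hab.symm] at h1 ⊢; omega
    · by_cases hy : x = some b ∧ y = some a
      · obtain ⟨rfl, rfl⟩ := hy
        simp [hab, hab.symm] at h1 ⊢; omega
      · have h3 : ¬ (y = some a ∧ x = some b) := by tauto
        simp only [hx, hy, h3, if_false, or_false] at h1 ⊢; omega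
  · intro v
    have h1 := hd v
    have h2 := hc v
    have h3 : inDeg (fun x y => if x = some a ∧ y = some b then o x y + 1 else o x y) (some v)
        = inDeg o (some v) + (if v = b then 1 else 0) := by
      have h1 := sum_ite_and (some v) (some a) (some b)
      simp only [Option.some.injEq] at h1
      rw [← h1]
      unfold inDeg
      rw [← Finset.sum_add_distrib]
      refine Finset.sum_congr rfl fun x _ => ?_
      by_cases hx : x = some a ∧ v = b
      · obtain ⟨rfl, rfl⟩ := hx
        simp
      · simp only [Option.some.injEq, hx, if_false]; rfl
    rw [h3]
    by_cases hva : v = a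
    · subst hva; simp [hab] at h1 ⊢; omega
    · by_cases hvb : v = b
      · subst hvb; simp [hva] at h1 ⊢; omega
      · simp [hva, hvb] at h1 ⊢; omega
  · simp
  · have h1 := hd b
    have h2 := hst b
    simp [hab.symm] at h1 ⊢; omega
  · simp [fA]

lemma sum_subt (b : V) (f : V → ℕ) :
    ∑ v : V, f v = f b + ∑ w : {v : V // v ≠ b}, f w.1 := by
  rw [← Finset.add_sum_erase _ _ (Finset.mem_univ b)]
  congr 1
  refine Finset.sum_subtype _ (fun x => by simp) f

lemma sum_opt_subt (b : V) (f : Option V → ℕ) :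
    ∑ v : Option V, f v = f none + f (some b) + ∑ w : {v : V // v ≠ b}, f (some w.1) := by
  rw [Fintype.sum_option, sum_subt b (fun v => f (some v)), add_assoc]

lemma deg_contract_a {m : Option V → Option V → ℕ} (hs : ∀ u w, m u w = m w u)
    (hl : ∀ u, m u u = 0) {a b : V} (hab : a ≠ b) (hk : 1 ≤ m (some a) (some b)) :
    deg (contractM m a b) (some ⟨a, hab⟩) + m (some a) (some b) + 1
      = deg m (some a) + deg m (some b) := by
  unfold deg
  rw [Fintype.sum_option, sum_opt_subt b, sum_opt_subt b]
  have key : ∑ w : {v : V // v ≠ b}, contractM m a b (some ⟨a, hab⟩) (some w)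
      + m (some a) (some b)
      = ∑ w : {v : V // v ≠ b}, m (some a) (some w.1) + ∑ w : {v : V // v ≠ b},
        m (some b) (some w.1) := by
    have : m (some a) (some b) = ∑ w : {v : V // v ≠ b},
      if w = ⟨a, hab⟩ then m (some a) (some b) else 0 := by simp
    rw [this, ← Finset.sum_add_distrib, ← Finset.sum_add_distrib]
    refine Finset.sum_congr rfl fun w _ => ?_
    by_cases hw : w = ⟨a, hab⟩
    · subst hw; simp [contractM, hl, hs (some b) (some a)]
    · have hw' : w.1 ≠ a := fun h => hw (Subtype.ext h)
      simp [contractM, hw, hw']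
  have h1 : contractM m a b (some ⟨a, hab⟩) none
      = m none (some a) + m none (some b) + (m (some a) (some b) - 1) := by simp [contractM]
  rw [h1, hs (some a) none, hs (some b) none, hl]
  omega

lemma deg_contract_ne {m : Option V → Option V → ℕ}
    {a b : V} (hab : a ≠ b) (v : {v : V // v ≠ b}) (hv : v.1 ≠ a) :
    deg (contractM m a b) (some v) = deg m (some v.1) := by
  unfold deg
  rw [Fintype.sum_option, sum_opt_subt b]
  have key : ∑ w : {v : V // v ≠ b}, contractM m a b (some v) (some w)
      = ∑ w : {v : V // v ≠ b}, m (some v.1) (some w.1) + m (some v.1) (some b) := by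
    have : m (some v.1) (some b) = ∑ w : {v : V // v ≠ b},
      if w = ⟨a, hab⟩ then m (some v.1) (some b) else 0 := by simp
    rw [this, ← Finset.sum_add_distrib]
    refine Finset.sum_congr rfl fun w _ => ?_
    by_cases hw : w = ⟨a, hab⟩
    · subst hw; simp [contractM, hv]
    · have hw' : w.1 ≠ a := fun h => hw (Subtype.ext h)
      simp [contractM, hv, hw, hw']
  have h1 : contractM m a b (some v) none = m (some v.1) none := by simp [contractM, hv]
  rw [h1, key]
  omega

/-- The orientation of the contraction induced by `o`. -/
def contractO (k : ℕ) (o : Option V → Option V → ℕ) (a b : V) :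
    Option {v : V // v ≠ b} → Option {v : V // v ≠ b} → ℕ
  | none, none => 0
  | none, some w =>
      if w.1 = a then o none (some a) + o none (some b) + (k - 1)
      else o none (some w.1)
  | some u, none =>
      if u.1 = a then o (some a) none + o (some b) none
      else o (some u.1) none
  | some u, some w =>
      if u.1 = a then
        (if w.1 = a then 0 else o (some a) (some w.1) + o (some b) (some w.1))
      else if w.1 = a then o (some u.1) (some a) + o (some u.1) (some b)
      else o (some u.1) (some w.1)

lemma contractO_orient {m o : Option V → Option V → ℕ} (hs : ∀ u w, m u w = m w u)
    (ho : IsOrientation m o) (a b : V) :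
    IsOrientation (contractM m a b) (contractO (m (some a) (some b)) o a b) := by
  rintro (_ | u) (_ | w)
  · rfl
  · have h1 := ho none (some a)
    have h2 := ho none (some b)
    have h3 := ho none (some w.1)
    simp only [contractM, contractO]
    split_ifs <;> omega
  · have h1 := ho none (some a)
    have h2 := ho none (some b)
    have h3 := ho (some u.1) none
    simp only [contractM, contractO]
    split_ifs <;> omega
  · have h1 := ho (some a) (some w.1)
    have h2 := ho (some b) (some w.1)
    have h3 := ho (some u.1) (some a)
    have h4 := ho (some u.1) (some b)
    have h5 := ho (some u.1) (some w.1)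
    simp only [contractM, contractO]
    split_ifs <;> omega

lemma contractO_in_a {m o : Option V → Option V → ℕ}
    (hl : ∀ u, m u u = 0) (ho : IsOrientation m o) {a b : V} (hab : a ≠ b)
    (hk : 1 ≤ m (some a) (some b)) :
    inDeg (contractO (m (some a) (some b)) o a b) (some ⟨a, hab⟩) + 1
      = inDeg o (some a) + inDeg o (some b) := by
  unfold inDeg
  rw [Fintype.sum_option, sum_opt_subt b, sum_opt_subt b]
  have key : ∑ w : {v : V // v ≠ b},
        contractO (m (some a) (some b)) o a b (some w) (some ⟨a, hab⟩)
      + o (some a) (some b)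
      = ∑ w : {v : V // v ≠ b}, o (some w.1) (some a) + ∑ w : {v : V // v ≠ b},
        o (some w.1) (some b) := by
    have : o (some a) (some b) = ∑ w : {v : V // v ≠ b},
      if w = ⟨a, hab⟩ then o (some a) (some b) else 0 := by simp
    rw [this, ← Finset.sum_add_distrib, ← Finset.sum_add_distrib]
    refine Finset.sum_congr rfl fun w _ => ?_
    by_cases hw : w = ⟨a, hab⟩
    · subst hw; simp [contractO, self_zero hl ho]
    · have hw' : w.1 ≠ a := fun h => hw (Subtype.ext h)
      simp [contractO, hw, hw']
  have h1 : contractO (m (some a) (some b)) o a b none (some ⟨a, hab⟩)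
      = o none (some a) + o none (some b) + (m (some a) (some b) - 1) := by simp [contractO]
  have h2 := ho (some a) (some b)
  rw [h1, self_zero hl ho (some b)]
  omega

lemma contractO_in_ne {k : ℕ} {o : Option V → Option V → ℕ}
    {a b : V} (hab : a ≠ b) (v : {v : V // v ≠ b}) (hv : v.1 ≠ a) :
    inDeg (contractO k o a b) (some v) = inDeg o (some v.1) := by
  unfold inDeg
  rw [Fintype.sum_option, sum_opt_subt b]
  have key : ∑ w : {v : V // v ≠ b}, contractO k o a b (some w) (some v)
      = ∑ w : {v : V // v ≠ b}, o (some w.1) (some v.1) + o (some b) (some v.1) := by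
    have : o (some b) (some v.1) = ∑ w : {v : V // v ≠ b},
      if w = ⟨a, hab⟩ then o (some b) (some v.1) else 0 := by simp
    rw [this, ← Finset.sum_add_distrib]
    refine Finset.sum_congr rfl fun w _ => ?_
    by_cases hw : w = ⟨a, hab⟩
    · subst hw; simp [contractO, hv]
    · have hw' : w.1 ≠ a := fun h => hw (Subtype.ext h)
      simp [contractO, hv, hw, hw']
  have h1 : contractO k o a b none (some v) = o none (some v.1) := by simp [contractO, hv]
  rw [h1, key]
  omega

lemma lack_bound {m : Option V → Option V → ℕ} (hs : ∀ u w, m u w = m w u)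
    (hl : ∀ u, m u u = 0) {a b : V} (hab : a ≠ b) (hk : 1 ≤ m (some a) (some b))
    {η : V → ℕ} (h : Sto m η) :
    (deg m (some a) - η a) + (deg m (some b) - η b)
      ≤ deg (contractM m a b) (some ⟨a, hab⟩) := by
  obtain ⟨hst, o, ho, hc⟩ := h
  have hsc : ∀ u w, contractM m a b u w = contractM m a b w u := by
    intro u w
    rw [← contractO_orient hs ho a b u w, ← contractO_orient hs ho a b w u, add_comm]
  have h1 := inDeg_le hsc (contractO_orient hs ho a b) (some ⟨a, hab⟩)
  have h2 := contractO_in_a hl ho hab hk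
  have := hc a
  have := hc b
  omega

lemma fB_sto {m : Option V → Option V → ℕ} (hs : ∀ u w, m u w = m w u)
    (hl : ∀ u, m u u = 0) {a b : V} (hab : a ≠ b) (hk : 1 ≤ m (some a) (some b))
    {η : V → ℕ} (h : Sto m η) : Sto (contractM m a b) (fB m a b hab η) := by
  have hb := lack_bound hs hl hab hk h
  obtain ⟨hst, o, ho, hc⟩ := h
  refine ⟨fun v => ?_, _, contractO_orient hs ho a b, fun v => ?_⟩
  · by_cases hv : v = ⟨a, hab⟩
    · subst hv; simp [fB]
    · have hv' : v.1 ≠ a := fun h => hv (Subtype.ext h)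
      rw [deg_contract_ne hab v hv']
      simp only [fB, hv', if_false]
      exact hst v
  · by_cases hv : v = ⟨a, hab⟩
    · subst hv
      have h2 := contractO_in_a hl ho hab hk
      have := hc a
      have := hc b
      have := hst a
      have := hst b
      simp only [fB, if_true]
      omega
    · have hv' : v.1 ≠ a := fun h => hv (Subtype.ext h)
      rw [deg_contract_ne hab v hv', contractO_in_ne hab v hv']
      simp only [fB, hv', if_false]
      exact hc v

/-- The lift of an orientation of the contraction, with all `a,b` edges directed to `a`. -/
def liftO (m : Option V → Option V → ℕ) (a b : V) (hab : a ≠ b)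
    (p : Option {v : V // v ≠ b} → Option {v : V // v ≠ b} → ℕ) :
    Option V → Option V → ℕ := fun u w =>
  let A : Option {v : V // v ≠ b} := some ⟨a, hab⟩
  let π : Option V → Option {v : V // v ≠ b} := fun x =>
    x.elim none (fun v => if h : v = b then A else some ⟨v, h⟩)
  if u = some a then
    if w = some a then 0 else if w = some b then 0
    else m w (some a) - min (p (π w) A) (m w (some a))
  else if u = some b then
    if w = some a then m (some a) (some b) else if w = some b then 0
    else m w (some b) - min (p (π w) A - min (p (π w) A) (m w (some a))) (m w (some b))
  else if w = some a then min (p (π u) A) (m u (some a))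
  else if w = some b then min (p (π u) A - min (p (π u) A) (m u (some a))) (m u (some b))
  else p (π u) (π w)

lemma liftO_orient {m : Option V → Option V → ℕ} (hs : ∀ u w, m u w = m w u)
    (hl : ∀ u, m u u = 0) {a b : V} (hab : a ≠ b)
    {p : Option {v : V // v ≠ b} → Option {v : V // v ≠ b} → ℕ}
    (hp : IsOrientation (contractM m a b) p) : IsOrientation m (liftO m a b hab p) := by
  intro u w
  have e1 := hs u w
  have e2 := hs (some a) (some b)
  by_cases ua : u = some a
  · subst ua
    by_cases wa : w = some a
    · subst wa; simp [liftO, hl]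
    by_cases wb : w = some b
    · subst wb; simp [liftO, hab.symm]
    simp only [liftO, wa, wb, if_true, if_false]; omega
  by_cases ub : u = some b
  · subst ub
    by_cases wa : w = some a
    · subst wa; simp [liftO, hab.symm]; omega
    by_cases wb : w = some b
    · subst wb; simp [liftO, hab.symm, hl]
    simp only [liftO, wa, wb, ua, if_true, if_false]; omega
  by_cases wa : w = some a
  · subst wa; simp only [liftO, ua, ub, if_true, if_false]; omega
  by_cases wb : w = some b
  · subst wb; simp only [liftO, ua, ub, wa, if_true, if_false]; omega
  simp only [liftO, ua, ub, wa, wb, if_false]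
  rw [hp]
  rcases u with _ | u <;> rcases w with _ | w
  · simp [contractM, hl]
  · simp only [Option.some.injEq] at wa wb
    simp [contractM, wa, wb]
  · simp only [Option.some.injEq] at ua ub
    simp [contractM, ua, ub]
  · simp only [Option.some.injEq] at ua ub wa wb
    simp [contractM, ua, ub, wa, wb]

lemma liftO_in_a {m : Option V → Option V → ℕ} (hs : ∀ u w, m u w = m w u)
    (hl : ∀ u, m u u = 0) {a b : V} (hab : a ≠ b) (hk : 1 ≤ m (some a) (some b))
    {p : Option {v : V // v ≠ b} → Option {v : V // v ≠ b} → ℕ}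
    (hp : IsOrientation (contractM m a b) p) :
    inDeg p (some ⟨a, hab⟩) + 1
      ≤ inDeg (liftO m a b hab p) (some a) + inDeg (liftO m a b hab p) (some b) := by
  unfold inDeg
  rw [Fintype.sum_option, sum_opt_subt b, sum_opt_subt b]
  have key : ∑ w : {v : V // v ≠ b}, p (some w) (some ⟨a, hab⟩)
      ≤ ∑ w : {v : V // v ≠ b}, liftO m a b hab p (some w.1) (some a)
        + ∑ w : {v : V // v ≠ b}, liftO m a b hab p (some w.1) (some b) := by
    rw [← Finset.sum_add_distrib]
    refine Finset.sum_le_sum fun w _ => ?_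
    have h1 := hp (some w) (some ⟨a, hab⟩)
    obtain ⟨w, hw⟩ := w
    by_cases hwa : w = a
    · subst hwa
      simp [contractM] at h1
      omega
    · simp [contractM, hwa] at h1
      simp [liftO, hwa, hw, hab.symm]
      omega
  have h1 := hp none (some ⟨a, hab⟩)
  simp [contractM] at h1
  have h2 : p none (some ⟨a, hab⟩) ≤ liftO m a b hab p none (some a)
      + liftO m a b hab p none (some b) + (m (some a) (some b) - 1) := by
    simp [liftO, hab.symm]
    omega
  have h3 : liftO m a b hab p (some b) (some a) = m (some a) (some b) := by
    simp [liftO, hab.symm]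
  omega

lemma liftO_in_ne {m : Option V → Option V → ℕ} (hs : ∀ u w, m u w = m w u)
    {a b : V} (hab : a ≠ b)
    {p : Option {v : V // v ≠ b} → Option {v : V // v ≠ b} → ℕ}
    (hp : IsOrientation (contractM m a b) p) (v : {v : V // v ≠ b}) (hv : v.1 ≠ a) :
    inDeg p (some v) ≤ inDeg (liftO m a b hab p) (some v.1) := by
  obtain ⟨v, hvb⟩ := v
  simp only at hv
  unfold inDeg
  rw [Fintype.sum_option, sum_opt_subt b]
  have key : ∑ w : {v : V // v ≠ b}, p (some w) (some ⟨v, hvb⟩)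
      ≤ ∑ w : {v : V // v ≠ b}, liftO m a b hab p (some w.1) (some v)
        + liftO m a b hab p (some b) (some v) := by
    have : liftO m a b hab p (some b) (some v) = ∑ w : {v : V // v ≠ b},
      if w = ⟨a, hab⟩ then liftO m a b hab p (some b) (some v) else 0 := by simp
    rw [this, ← Finset.sum_add_distrib]
    refine Finset.sum_le_sum fun w _ => ?_
    obtain ⟨w, hw⟩ := w
    have h1 := hp (some ⟨w, hw⟩) (some ⟨v, hvb⟩)
    by_cases hwa : w = a
    · subst hwa
      have e1 := hs (some w) (some v)
      have e2 := hs (some b) (some v)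
      simp [contractM, hv] at h1
      simp [liftO, hv, hvb, hab.symm]
      omega
    · simp [liftO, hwa, hw, hv, hvb]
  have h1 : liftO m a b hab p none (some v) = p none (some ⟨v, hvb⟩) := by
    simp [liftO, hv, hvb]
  simp only [h1]
  omega

lemma fB_pre {m : Option V → Option V → ℕ} (hs : ∀ u w, m u w = m w u)
    (hl : ∀ u, m u u = 0) {a b : V} (hab : a ≠ b) (hk : 1 ≤ m (some a) (some b))
    {ξ : {v : V // v ≠ b} → ℕ} (h : Sto (contractM m a b) ξ) :
    ∃ η, Sto m η ∧ fB m a b hab η = ξ := by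
  obtain ⟨hst, p, hp, hc⟩ := h
  have hA := hc ⟨a, hab⟩
  have hstA := hst ⟨a, hab⟩
  obtain ⟨o, ho, hin, hne, ha1, hb1⟩ : ∃ o, IsOrientation m o ∧
      inDeg p (some ⟨a, hab⟩) + 1 ≤ inDeg o (some a) + inDeg o (some b) ∧
      (∀ v : {v : V // v ≠ b}, v.1 ≠ a → inDeg p (some v) ≤ inDeg o (some v.1)) ∧
      1 ≤ inDeg o (some a) ∧ 1 ≤ inDeg o (some b) := by
    have ho := liftO_orient hs hl hab hp
    have h1 := liftO_in_a hs hl hab hk hp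
    have h2 := liftO_in_ne hs hab hp
    have h3 : liftO m a b hab p (some b) (some a) = m (some a) (some b) := by
      simp [liftO, hab.symm]
    generalize liftO m a b hab p = o at *
    have h4 : o (some b) (some a) ≤ inDeg o (some a) :=
      Finset.single_le_sum (f := fun x => o x (some a)) (fun _ _ => Nat.zero_le _)
        (Finset.mem_univ (some b))
    by_cases hb : 1 ≤ inDeg o (some b)
    · exact ⟨o, ho, h1, h2, by omega, hb⟩
    · have hne : some b ≠ some a := by simpa using hab.symm
      have hba : 1 ≤ o (some b) (some a) := by omega
      have hf := flipO_inDeg o hne hba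
      have fa := hf (some a)
      have fb := hf (some b)
      simp [hab, hab.symm] at fa fb
      refine ⟨flipO o (some b) (some a), flipO_orient ho hne hba, by omega, ?_, by omega, by omega⟩
      intro v hv
      have := hf (some v.1)
      have hvb := v.2
      simp [hv, hvb] at this
      have := h2 v hv
      omega
  have da := inDeg_le hs ho (some a)
  have db := inDeg_le hs ho (some b)
  obtain ⟨c, hcdef⟩ : ∃ c, c = deg (contractM m a b) (some ⟨a, hab⟩) - ξ ⟨a, hab⟩ := ⟨_, rfl⟩
  obtain ⟨j, hj⟩ : ∃ j, j = min c (inDeg o (some b) - 1) := ⟨_, rfl⟩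
  refine ⟨fun v => if h : v = b then deg m (some b) - j else
    if v = a then deg m (some a) - (c - j) else ξ ⟨v, h⟩, ⟨fun v => ?_, o, ho, fun v => ?_⟩, ?_⟩
  · by_cases hvb : v = b
    · subst hvb; simp
    · by_cases hva : v = a
      · subst hva; simp [hvb]
      · have := hst ⟨v, hvb⟩
        rw [deg_contract_ne hab ⟨v, hvb⟩ hva] at this
        simp [hva, hvb]; exact this
  · by_cases hvb : v = b
    · subst hvb; simp; omega
    · by_cases hva : v = a
      · subst hva; simp [hvb]; omega
      · have h1 := hc ⟨v, hvb⟩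
        have h2 := hne ⟨v, hvb⟩ hva
        rw [deg_contract_ne hab ⟨v, hvb⟩ hva] at h1
        simp only [hva, hvb, dite_false, if_false] at h1 h2 ⊢
        omega
  · funext v
    obtain ⟨v, hvb⟩ := v
    by_cases hva : v = a
    · subst hva; simp [fB, hvb]; omega
    · simp [fB, hva, hvb]

lemma fB_surj {m : Option V → Option V → ℕ} (hs : ∀ u w, m u w = m w u)
    (hl : ∀ u, m u u = 0) {a b : V} (hab : a ≠ b) (hk : 1 ≤ m (some a) (some b))
    {ξ : {v : V // v ≠ b} → ℕ} (h : Sto (contractM m a b) ξ) :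
    ∃ η, StoB m a b η ∧ fB m a b hab η = ξ := by
  have main : ∀ n (η : V → ℕ), n = deg m (some b) - η b → Sto m η → fB m a b hab η = ξ →
      ∃ η, StoB m a b η ∧ fB m a b hab η = ξ := by
    intro n
    induction n using Nat.strong_induction_on with
    | _ n ih =>
      intro η hn hη hf
      by_cases hA : StoA m a b η
      · obtain ⟨hst, o, ho, hc, hoab, hlb⟩ := hA
        have hne : some a ≠ some b := by simpa using hab
        have hηa : 1 ≤ η a := by
          have := hc a; have := inDeg_le hs ho (some a); omega
        have hsta := hst a
        let η' : V → ℕ := fun v => if v = a then η a - 1 else if v = b then η b + 1 else η v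
        have ea : η' a = η a - 1 := by simp [η']
        have eb : η' b = η b + 1 := by simp [η', hab.symm]
        have ev : ∀ v, v ≠ a → v ≠ b → η' v = η v := fun v h1 h2 => by simp [η', h1, h2]
        refine ih (deg m (some b) - η' b) (by omega) η' rfl ⟨fun v => ?_, flipO o (some a) (some b),
          flipO_orient ho hne hoab, fun v => ?_⟩ ?_
        · have := hst v
          by_cases hva : v = a
          · subst hva; omega
          · by_cases hvb : v = b
            · subst hvb; omega
            · rw [ev v hva hvb]; exact this
        · have h1 := hc v
          have h2 := flipO_inDeg o hne hoab (some v)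
          by_cases hva : v = a
          · subst hva; simp [hab] at h2; omega
          · by_cases hvb : v = b
            · subst hvb; simp [hva] at h2; omega
            · simp [hva, hvb] at h2
              rw [ev v hva hvb]; omega
        · rw [← hf]
          funext v
          obtain ⟨v, hvb⟩ := v
          by_cases hva : v = a
          · subst hva
            simp only [fB, if_true, ea, eb]
            omega
          · simp only [fB, hva, if_false]
            exact ev v hva hvb
      · exact ⟨η, ⟨hη, hA⟩, hf⟩
  obtain ⟨η, h1, h2⟩ := fB_pre hs hl hab hk h
  exact main _ η rfl h1 h2

lemma fB_inj {m : Option V → Option V → ℕ} (hs : ∀ u w, m u w = m w u)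
    (hl : ∀ u, m u u = 0) {a b : V} (hab : a ≠ b) (hk : 1 ≤ m (some a) (some b))
    {η η' : V → ℕ} (h : StoB m a b η) (h' : StoB m a b η')
    (he : fB m a b hab η = fB m a b hab η') : η = η' := by
  have hoff : ∀ v, v ≠ a → v ≠ b → η v = η' v := by
    intro v hva hvb
    have := congrFun he ⟨v, hvb⟩
    simpa [fB, hva] using this
  have hsum : η a + η b = η' a + η' b := by
    have := congrFun he ⟨a, hab⟩
    simp only [fB, if_true] at this
    have := lack_bound hs hl hab hk h.1
    have := lack_bound hs hl hab hk h'.1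
    have := h.1.1 a
    have := h.1.1 b
    have := h'.1.1 a
    have := h'.1.1 b
    omega
  rcases lt_trichotomy (η b) (η' b) with hlt | heq | hlt
  · exact absurd (stoA_of_lt hab hk h'.1 h.1 (fun v h1 h2 => (hoff v h1 h2).symm) hsum.symm hlt) h.2
  · funext v
    by_cases hva : v = a
    · subst hva; omega
    · by_cases hvb : v = b
      · subst hvb; exact heq
      · exact hoff v hva hvb
  · exact absurd (stoA_of_lt hab hk h.1 h'.1 hoff hsum hlt) h'.2

lemma stoA_pos {m : Option V → Option V → ℕ} (hs : ∀ u w, m u w = m w u)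
    {a b : V} {η : V → ℕ} (h : StoA m a b η) : 1 ≤ η a := by
  obtain ⟨_, o, ho, hc, _⟩ := h
  have := hc a; have := inDeg_le hs ho (some a); omega

/-- `f` is a bijection from `Sto(G)` onto the disjoint union
`Sto(G∖e) ⊔ Sto(G.e)`; moreover `ℓ(f(η)) = ℓ(η) − 1` on `Sto_A(G)` and
`ℓ(f(η)) = ℓ(η)` on `Sto_B(G)`. -/
theorem fMap_bijOn (m : Option V → Option V → ℕ) (hG : IsGraph m)
    (a b : V) (hab : a ≠ b) (hk : 1 ≤ m (some a) (some b))
    (hnotbridge : (SimpleGraph.fromRel fun u w : Option V =>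
      deleteM m a b u w ≠ 0).Connected) :
    Set.BijOn (fMap m a b hab) {η : V → ℕ | Sto m η}
      {x : (V → ℕ) ⊕ ({v : V // v ≠ b} → ℕ) |
        Sum.elim (fun η' => Sto (deleteM m a b) η')
          (fun η' => Sto (contractM m a b) η') x} ∧
    (∀ η : V → ℕ, StoA m a b η →
      totalLacking (deleteM m a b) (fA a η) + 1 = totalLacking m η) ∧
    (∀ η : V → ℕ, StoB m a b η →
      totalLacking (contractM m a b) (fB m a b hab η) = totalLacking m η) := by
  obtain ⟨hs, hl, -⟩ := hG
  refine ⟨⟨?_, ?_, ?_⟩, ?_, ?_⟩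
  · intro η hη
    by_cases hA : StoA m a b η
    · simpa [fMap, hA] using fA_sto hs hab hk hA
    · simpa [fMap, hA] using fB_sto hs hl hab hk hη
  · intro η hη η' hη' he
    by_cases hA : StoA m a b η <;> by_cases hA' : StoA m a b η' <;>
      simp only [fMap, hA, hA', if_true, if_false, Sum.inl.injEq, Sum.inr.injEq, reduceCtorEq] at he
    · have h1 := stoA_pos hs hA
      have h2 := stoA_pos hs hA'
      funext v
      have h3 := congrFun he v
      by_cases hva : v = a
      · subst hva; simp [fA] at h3; omega
      · simpa [fA, hva] using h3
    · exact fB_inj hs hl hab hk ⟨hη, hA⟩ ⟨hη', hA'⟩ he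
  · rintro (ξ | ξ) hξ
    · obtain ⟨η, hη, he⟩ := fA_surj hs hab hk hξ
      refine ⟨η, ⟨hη.1, ?_⟩, by simp [fMap, hη, he]⟩
      obtain ⟨_, o, ho, hc, _⟩ := hη
      exact ⟨o, ho, hc⟩
    · obtain ⟨η, hη, he⟩ := fB_surj hs hl hab hk hξ
      exact ⟨η, hη.1, by simp [fMap, hη.2, he]⟩
  · intro η hη
    have hp := stoA_pos hs hη
    have hb : η b < deg m (some b) := by
      obtain ⟨_, o, ho, hc, _, h⟩ := hη
      exact h
    have e1 : (1 : ℕ) = ∑ v : V, if v = b then 1 else 0 := by simp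
    unfold totalLacking
    conv_lhs => rw [e1]
    rw [← Finset.sum_add_distrib]
    refine Finset.sum_congr rfl fun v _ => ?_
    have h1 := deg_delete hs hab hk v
    by_cases hva : v = a
    · subst hva; simp [fA, hab] at h1 ⊢; omega
    · by_cases hvb : v = b
      · subst hvb; simp [fA, hva] at h1 ⊢; omega
      · simp [fA, hva, hvb] at h1 ⊢; omega
  · intro η hη
    have hb := lack_bound hs hl hab hk hη.1
    unfold totalLacking
    rw [sum_subt b (fun v => deg m (some v) - η v)]
    have e1 : deg m (some b) - η b = ∑ w : {v : V // v ≠ b},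
      if w = ⟨a, hab⟩ then deg m (some b) - η b else 0 := by simp
    rw [e1, ← Finset.sum_add_distrib]
    refine Finset.sum_congr rfl fun w _ => ?_
    by_cases hw : w = ⟨a, hab⟩
    · subst hw; simp [fB]; omega
    · have hw' : w.1 ≠ a := fun h => hw (Subtype.ext h)
      rw [deg_contract_ne hab w hw']
      simp [fB, hw, hw']

end SSM
end

section
/- The restriction of f to Sto_A(G), given by η ↦ η − 1_a, is a bijection from Sto_A(G) onto Sto(G∖e). -/
open Finset Polynomial

open scoped Classical

namespace SSM

variable {V : Type*} [Fintype V] [DecidableEq V]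

theorem aux_sum (f g : Option V → ℕ) (x : Option V)
    (h : ∀ w, f w = g w + if w = x then 1 else 0) : ∑ w, f w = ∑ w, g w + 1 := by
  rw [Finset.sum_congr rfl (fun w _ => h w), Finset.sum_add_distrib]
  simp

theorem aux_deg (m : Option V → Option V → ℕ) (hs : ∀ u w, m u w = m w u)
    (a b : V) (hab : a ≠ b) (hk : 1 ≤ m (some a) (some b)) :
    deg m (some a) = deg (deleteM m a b) (some a) + 1 ∧
    deg m (some b) = deg (deleteM m a b) (some b) + 1 ∧
    ∀ v, v ≠ a → v ≠ b → deg m (some v) = deg (deleteM m a b) (some v) := by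
  have hk' : 1 ≤ m (some b) (some a) := by rw [hs]; exact hk
  refine ⟨aux_sum _ _ (some b) ?_, aux_sum _ _ (some a) ?_, ?_⟩
  · intro w
    by_cases h : w = some b
    · subst h; simp [deleteM]; omega
    · simp [deleteM, h, hab]
  · intro w
    by_cases h : w = some a
    · subst h; simp [deleteM]; omega
    · simp [deleteM, h, hab.symm]
  · intro v h1 h2
    simp [deg, deleteM, h1, h2]

theorem aux_inDeg (o o' : Option V → Option V → ℕ) (a b : V)
    (h : ∀ u w, o u w = o' u w + if u = some a ∧ w = some b then 1 else 0) :
    inDeg o (some b) = inDeg o' (some b) + 1 ∧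
    ∀ v, v ≠ b → inDeg o (some v) = inDeg o' (some v) := by
  refine ⟨aux_sum _ _ (some a) ?_, ?_⟩
  · intro w
    rw [h]; simp
  · intro v hv
    simp [inDeg, h, hv]

theorem aux_pos (m : Option V → Option V → ℕ) (a b : V) (η : V → ℕ)
    (h : StoA m a b η) : 1 ≤ η a := by
  obtain ⟨_, o, ho, hc, _, _⟩ := h
  have h1 := hc a
  have h2 : inDeg o (some a) ≤ deg m (some a) := by
    refine Finset.sum_le_sum fun w _ => ?_
    have := ho (some a) w
    omega
  omega

/-- the restriction of `f` to `Sto_A(G)`, given by `η ↦ η − 1_a`,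
is a bijection from `Sto_A(G)` onto `Sto(G∖e)`. -/
theorem fA_bijOn (m : Option V → Option V → ℕ) (hG : IsGraph m)
    (a b : V) (hab : a ≠ b) (hk : 1 ≤ m (some a) (some b))
    (hnotbridge : (SimpleGraph.fromRel fun u w : Option V =>
      deleteM m a b u w ≠ 0).Connected) :
    Set.BijOn (fA a) {η : V → ℕ | StoA m a b η}
      {η' : V → ℕ | Sto (deleteM m a b) η'} := by
  obtain ⟨hs, -, -⟩ := hG
  obtain ⟨da, db, dv⟩ := aux_deg m hs a b hab hk
  have hk' : 1 ≤ m (some b) (some a) := by rw [hs]; exact hk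
  refine ⟨?_, ?_, ?_⟩
  · intro η hη
    have hp := aux_pos m a b η hη
    obtain ⟨hst, o, ho, hc, h1, hb⟩ := hη
    let o' : Option V → Option V → ℕ := fun u w =>
      if u = some a ∧ w = some b then o u w - 1 else o u w
    obtain ⟨ib, iv⟩ := aux_inDeg o o' a b (by
      intro u w
      by_cases h : u = some a ∧ w = some b
      · obtain ⟨rfl, rfl⟩ := h
        simp [o']; omega
      · simp [o', h])
    refine ⟨?_, o', ?_, ?_⟩
    · intro v
      have := hst v
      by_cases hva : v = a
      · subst hva; simp [fA]; omega
      · by_cases hvb : v = b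
        · subst hvb; simp [fA, hva]; omega
        · have := dv v hva hvb
          simp [fA, hva]; omega
    · intro u w
      have := ho u w
      simp only [o', deleteM]
      by_cases h : u = some a ∧ w = some b
      · obtain ⟨rfl, rfl⟩ := h
        simp [hab.symm]; omega
      · by_cases h2 : u = some b ∧ w = some a
        · obtain ⟨rfl, rfl⟩ := h2
          simp [hab.symm]; omega
        · rw [if_neg h, if_neg (by tauto), if_neg (by tauto)]
          exact this
    · intro v
      have := hc v
      by_cases hva : v = a
      · subst hva
        have := iv v hab
        simp [fA]; omega
      · by_cases hvb : v = b
        · subst hvb; simp [fA, hva]; omega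
        · have := dv v hva hvb
          have := iv v hvb
          simp [fA, hva]; omega
  · intro η hη η' hη' he
    have hp := aux_pos m a b η hη
    have hp' := aux_pos m a b η' hη'
    funext v
    have hv := congrFun he v
    by_cases hva : v = a
    · subst hva
      simp [fA] at hv
      omega
    · simpa [fA, hva] using hv
  · rintro η ⟨hst, o, ho, hc⟩
    let o' : Option V → Option V → ℕ := fun u w =>
      o u w + if u = some a ∧ w = some b then 1 else 0
    obtain ⟨ib, iv⟩ := aux_inDeg o' o a b (fun u w => by simp [o'])
    refine ⟨Function.update η a (η a + 1), ⟨?_, o', ?_, ?_, ?_, ?_⟩, ?_⟩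
    · intro v
      have := hst v
      by_cases hva : v = a
      · subst hva; simp; omega
      · by_cases hvb : v = b
        · subst hvb; simp [hva]; omega
        · have := dv v hva hvb
          simp [hva]; omega
    · intro u w
      have := ho u w
      simp only [o', deleteM] at this ⊢
      by_cases h : u = some a ∧ w = some b
      · obtain ⟨rfl, rfl⟩ := h
        simp [hab.symm] at this ⊢; omega
      · by_cases h2 : u = some b ∧ w = some a
        · obtain ⟨rfl, rfl⟩ := h2
          simp [hab.symm] at this ⊢; omega
        · rw [if_neg (by tauto)] at this
          rw [if_neg h, if_neg (by tauto)]
          exact this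
    · intro v
      have := hc v
      by_cases hva : v = a
      · subst hva
        have := iv v hab
        simp; omega
      · by_cases hvb : v = b
        · subst hvb; simp [hva]; omega
        · have := dv v hva hvb
          have := iv v hvb
          simp [hva]; omega
    · simp [o']
    · have := hst b
      simp [hab.symm]; omega
    · funext v
      by_cases hva : v = a
      · subst hva; simp [fA]
      · simp [fA, hva]

end SSM
end

section
/- In the Abelian sandpile model on G, stabilisation always terminates: from any configuration η on G, every sequence of legal full topplings is finite, and there exists a finite sequence of legal full topplings leading from η to a stable configuration. -/
open Finset Polynomial

open scoped Classical

namespace SSM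

variable {V : Type*} [Fintype V] [DecidableEq V]

lemma exists_weight (m : Option V → Option V → ℕ) (hG : IsGraph m) :
    ∃ w : Option V → ℤ, w none = 0 ∧ (∀ u, 0 ≤ w u) ∧
      ∀ x : V, ∑ u : Option V, (m (some x) u : ℤ) * w u < (deg m (some x) : ℤ) * w (some x) := by
  obtain ⟨hs, hl, hc⟩ := hG
  set G := SimpleGraph.fromRel fun u w : Option V => m u w ≠ 0 with hGdef
  let d : Option V → ℕ := fun u => G.dist u none
  let N : ℕ := ∑ u, d u
  have hdN : ∀ u, d u ≤ N := fun u =>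
    Finset.single_le_sum (f := d) (fun i _ => Nat.zero_le _) (Finset.mem_univ u)
  let B : ℕ := 1 + ∑ u, deg m u
  have hB : ∀ u, deg m u < B := fun u => by
    have := Finset.single_le_sum (f := deg m) (fun i _ => Nat.zero_le _) (Finset.mem_univ u)
    simp only [B]; omega
  have hB1 : 1 ≤ B := by simp [B]
  let p : Option V → ℕ := fun u => B ^ (N - d u)
  have hp : ∀ u, 0 < p u := fun u => Nat.pow_pos hB1
  have key : ∀ x : V, deg m (some x) * p (some x) < ∑ u : Option V, m (some x) u * p u := by
    intro x
    obtain ⟨q, hq⟩ := (hc.preconnected (some x) none).exists_walk_length_eq_dist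
    cases q with
    | @cons _ y _ h q =>
      have h1 : d y ≤ q.length := SimpleGraph.dist_le q
      have h2 : q.length + 1 = d (some x) := by simpa using hq
      have h3 : m (some x) y ≠ 0 := by
        rw [hGdef, SimpleGraph.fromRel_adj] at h
        rcases h.2 with h | h
        · exact h
        · rwa [hs]
      have h4 := hdN (some x)
      have h5 : B * p (some x) ≤ p y := by
        simp only [p]
        rw [← pow_succ']
        exact Nat.pow_le_pow_right hB1 (by omega)
      calc deg m (some x) * p (some x) < B * p (some x) :=
            Nat.mul_lt_mul_of_pos_right (hB _) (hp _)
        _ ≤ p y := h5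
        _ ≤ m (some x) y * p y := Nat.le_mul_of_pos_left _ (Nat.pos_of_ne_zero h3)
        _ ≤ _ := Finset.single_le_sum (f := fun u => m (some x) u * p u)
            (fun i _ => Nat.zero_le _) (Finset.mem_univ y)
  refine ⟨fun u => (p none : ℤ) - p u, by simp, ?_, ?_⟩
  · intro u
    have : p u ≤ p none := Nat.pow_le_pow_right hB1 (by simp [d])
    simp only [sub_nonneg]
    exact_mod_cast this
  · intro x
    have h := key x
    have h' : (deg m (some x) : ℤ) * p (some x) < ∑ u : Option V, (m (some x) u : ℤ) * p u := by
      exact_mod_cast h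
    have h2 : (deg m (some x) : ℤ) = ∑ u : Option V, (m (some x) u : ℤ) := by
      simp [deg]
    simp only [mul_sub, Finset.sum_sub_distrib, ← Finset.sum_mul]
    rw [← h2]
    linarith

lemma exists_potential (m : Option V → Option V → ℕ) (hG : IsGraph m) :
    ∃ Φ : (V → ℕ) → ℕ, ∀ η η', FullTopple m η η' → Φ η' < Φ η := by
  obtain ⟨w, hw0, hw, hlt⟩ := exists_weight m hG
  have hnn : ∀ η : V → ℕ, 0 ≤ ∑ v : V, (η v : ℤ) * w (some v) := fun η =>
    Finset.sum_nonneg fun v _ => mul_nonneg (by positivity) (hw _)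
  refine ⟨fun η => (∑ v : V, (η v : ℤ) * w (some v)).toNat, ?_⟩
  rintro η η' ⟨x, hx, h⟩
  have e : ∀ v, (η' v : ℤ) * w (some v) = (η v : ℤ) * w (some v) +
      (m (some x) (some v) : ℤ) * w (some v) -
      if v = x then (deg m (some x) : ℤ) * w (some x) else 0 := by
    intro v
    by_cases hv : v = x
    · subst hv
      rw [h v, if_pos rfl, if_pos rfl, hG.2.1, Nat.cast_sub hx.le]
      push_cast; ring
    · rw [h v, if_neg hv, if_neg hv]
      push_cast; ring
  have h1 := hlt x
  rw [Fintype.sum_option, hw0] at h1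
  have h2 : ∑ v : V, (η' v : ℤ) * w (some v) < ∑ v : V, (η v : ℤ) * w (some v) := by
    rw [Finset.sum_congr rfl fun v _ => e v, Finset.sum_sub_distrib, Finset.sum_add_distrib]
    simp only [Finset.sum_ite_eq', Finset.mem_univ, if_true]
    linarith
  have := hnn η'
  show Int.toNat _ < Int.toNat _
  omega

/-- In the Abelian sandpile model, stabilisation always terminates:
from any configuration, every sequence of legal full topplings is finite, and some
finite sequence of legal full topplings leads to a stable configuration. -/
theorem asm_stabilisation_terminates (m : Option V → Option V → ℕ) (hG : IsGraph m)
    (η : V → ℕ) :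
    (∀ seq : ℕ → (V → ℕ), seq 0 = η →
      ¬ ∀ n : ℕ, FullTopple m (seq n) (seq (n + 1))) ∧
    (∃ η' : V → ℕ, Relation.ReflTransGen (FullTopple m) η η' ∧ Stable m η') := by
  obtain ⟨Φ, hΦ⟩ := exists_potential m hG
  constructor
  · intro seq _ hseq
    have h : ∀ n, Φ (seq n) + n ≤ Φ (seq 0) := by
      intro n
      induction n with
      | zero => simp
      | succ n ih =>
        have := hΦ _ _ (hseq n)
        omega
    have := h (Φ (seq 0) + 1)
    omega
  · induction hn : Φ η using Nat.strong_induction_on generalizing η with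
    | _ n ih =>
      by_cases hst : Stable m η
      · exact ⟨η, Relation.ReflTransGen.refl, hst⟩
      · simp only [Stable, not_forall, not_le] at hst
        obtain ⟨x, hx⟩ := hst
        have ht : FullTopple m η (fun v => if v = x then η x - deg m (some x)
            else η v + m (some x) (some v)) := ⟨x, hx, fun v => rfl⟩
        obtain ⟨η', h1, h2⟩ := ih _ (hn ▸ hΦ _ _ ht) _ rfl
        exact ⟨η', Relation.ReflTransGen.head ht h1, h2⟩

end SSM
end
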